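/- arXiv:2605.26534 — 4 statements merged into one kernel-verified Lean document; each statement's English description precedes it below -/
import Mathlib

section
/- Let P = {x ∈ ℝ^m : ∀ i, ⟪a i, x⟫ ≤ b i} be a nonempty polyhedron defined by finitely many linear inequalities indexed by i : Fin n. Then there exists a subset I ⊆ Fin n such that the affine solution set F = {x ∈ ℝ^m : ∀ i ∈ I, ⟪a i, x⟫ = b i} is nonempty and F is contained in P (the minimal face of a nonempty polyhedron is an affine set obtained by turning a subsystem of the inequalities into equalities). -/
open InnerProductSpace

/-- If a point `x` of a polyhedron and a point `y` outside it are given, the segment from `x` to `y`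
leaves the polyhedron at a point where an inequality violated by `y` is tight; every equation
satisfied by both `x` and `y` still holds there. -/
theorem exists_tight_of_mem_of_notMem {ι E : Type*} [Finite ι] [NormedAddCommGroup E]
    [InnerProductSpace ℝ E] (a : ι → E) (b : ι → ℝ) {x y : E}
    (hx : ∀ i, ⟪a i, x⟫_ℝ ≤ b i) (hy : ∃ i, b i < ⟪a i, y⟫_ℝ) :
    ∃ z j, (∀ i, ⟪a i, z⟫_ℝ ≤ b i) ∧ b j < ⟪a j, y⟫_ℝ ∧ ⟪a j, z⟫_ℝ = b j ∧
      ∀ i, ⟪a i, x⟫_ℝ = b i → ⟪a i, y⟫_ℝ = b i → ⟪a i, z⟫_ℝ = b i := by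
  obtain ⟨j, hj, hmin⟩ := Set.exists_min_image {i | b i < ⟪a i, y⟫_ℝ}
    (fun i ↦ (b i - ⟪a i, x⟫_ℝ) / (⟪a i, y⟫_ℝ - ⟪a i, x⟫_ℝ)) (Set.toFinite _) hy
  have hpos : ∀ i, b i < ⟪a i, y⟫_ℝ → 0 < ⟪a i, y⟫_ℝ - ⟪a i, x⟫_ℝ :=
    fun i hi ↦ sub_pos.2 ((hx i).trans_lt hi)
  have hjpos := hpos j hj
  set t := (b j - ⟪a j, x⟫_ℝ) / (⟪a j, y⟫_ℝ - ⟪a j, x⟫_ℝ) with ht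
  have ht0 : 0 ≤ t := div_nonneg (sub_nonneg.2 (hx j)) hjpos.le
  have ht1 : t ≤ 1 := (div_le_one hjpos).2 (sub_le_sub_right (le_of_lt hj) _)
  have hz : ∀ i, ⟪a i, x + t • (y - x)⟫_ℝ =
      ⟪a i, x⟫_ℝ + t * (⟪a i, y⟫_ℝ - ⟪a i, x⟫_ℝ) := fun i ↦ by
    rw [inner_add_right, real_inner_smul_right, inner_sub_right]
  refine ⟨x + t • (y - x), j, fun i ↦ ?_, hj, ?_, fun i hxi hyi ↦ ?_⟩
  · rw [hz]
    by_cases hi : b i < ⟪a i, y⟫_ℝ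
    · linarith [(le_div_iff₀ (hpos i hi)).1 (hmin i hi)]
    · nlinarith [hx i, mul_nonneg ht0 (sub_nonneg.2 (not_lt.1 hi)),
        mul_nonneg (sub_nonneg.2 ht1) (sub_nonneg.2 (hx i))]
  · rw [hz, ht, div_mul_cancel₀ _ hjpos.ne']
    ring
  · rw [hz, hxi, hyi]
    ring

/-- The minimal face of a nonempty polyhedron: there is a subset of the
inequalities whose associated equality system has a nonempty solution set
contained in the polyhedron. -/
theorem minimal_face_of_polyhedron (m n : ℕ)
    (a : Fin n → EuclideanSpace ℝ (Fin m)) (b : Fin n → ℝ)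
    (hP : ({x : EuclideanSpace ℝ (Fin m) | ∀ i : Fin n, ⟪a i, x⟫_ℝ ≤ b i}).Nonempty) :
    ∃ I : Finset (Fin n),
      ({x : EuclideanSpace ℝ (Fin m) | ∀ i ∈ I, ⟪a i, x⟫_ℝ = b i}).Nonempty ∧
      {x : EuclideanSpace ℝ (Fin m) | ∀ i ∈ I, ⟪a i, x⟫_ℝ = b i} ⊆
        {x : EuclideanSpace ℝ (Fin m) | ∀ i : Fin n, ⟪a i, x⟫_ℝ ≤ b i} := by
  obtain ⟨x₀, hx₀⟩ := hP
  obtain ⟨I, ⟨x, hxP, hxI⟩, hmax⟩ := Set.Finite.exists_maximal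
    (s := {I : Finset (Fin n) | ∃ x, (∀ i, ⟪a i, x⟫_ℝ ≤ b i) ∧ ∀ i ∈ I, ⟪a i, x⟫_ℝ = b i})
    (Set.toFinite _) ⟨∅, x₀, hx₀, by simp⟩
  refine ⟨I, ⟨x, hxI⟩, fun y hyI ↦ ?_⟩
  by_contra hyP
  obtain ⟨z, j, hzP, hyj, hzj, hz⟩ := exists_tight_of_mem_of_notMem a b hxP
    (y := y) (by simpa using hyP)
  have hjI : j ∈ I := hmax (y := insert j I)
    ⟨z, hzP, (Finset.forall_mem_insert _ _ _).2 ⟨hzj, fun i hi ↦ hz i (hxI i hi) (hyI i hi)⟩⟩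
    (Finset.subset_insert j I) (Finset.mem_insert_self j I)
  exact hyj.ne' (hyI j hjI)
end

section
/- Let P = {x ∈ ℝ^m : ∀ i, ⟪a i, x⟫ ≤ b i} be a nonempty polyhedron defined by finitely many linear inequalities indexed by i : Fin n. Then for every point f ∈ ℝ^m there exists a subset I ⊆ Fin n and a point y ∈ ℝ^m such that: (i) ⟪a i, y⟫ = b i for all i ∈ I, (ii) y ∈ P, and (iii) y minimizes the distance to f among all points of the affine set F = {x : ∀ i ∈ I, ⟪a i, x⟫ = b i} (i.e., y is the orthogonal projection of f onto F). Consequently, the set of feasible projection candidates is nonempty. -/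
open InnerProductSpace

/-- A nearest point `y` of a polyhedron to `f` is also nearest to `f` within the affine set cut out
by the constraints active at `y`. -/
theorem norm_sub_le_of_forall_active_eq {ι E : Type*} [Finite ι] [NormedAddCommGroup E]
    [InnerProductSpace ℝ E] {a : ι → E} {b : ι → ℝ} {f y : E}
    (hy : ∀ i, ⟪a i, y⟫_ℝ ≤ b i)
    (hmin : ∀ z, (∀ i, ⟪a i, z⟫_ℝ ≤ b i) → ‖y - f‖ ≤ ‖z - f‖)
    {x : E} (hx : ∀ i, ⟪a i, y⟫_ℝ = b i → ⟪a i, x⟫_ℝ = b i) :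
    ‖y - f‖ ≤ ‖x - f‖ := by
  by_contra! hlt
  have hfeas : ∀ᶠ t : ℝ in nhds 0, ∀ i, ⟪a i, y + t • (x - y)⟫_ℝ ≤ b i := by
    refine Filter.eventually_all.2 fun i => ?_
    rcases (hy i).eq_or_lt with hi | hi
    · refine Filter.Eventually.of_forall fun t => ?_
      simp [inner_add_right, inner_smul_right, inner_sub_right, hi, hx i hi]
    · have hc : Continuous fun t : ℝ => ⟪a i, y + t • (x - y)⟫_ℝ := by fun_prop
      have hev := hc.continuousAt.eventually_lt (x₀ := 0) (continuousAt_const (y := b i))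
        (by simpa using hi)
      exact hev.mono fun t ht => ht.le
  obtain ⟨t, ht, ht0, ht1⟩ := ((hfeas.filter_mono nhdsWithin_le_nhds).and
    (Ioo_mem_nhdsGT (zero_lt_one (α := ℝ)))).exists
  have hle : ‖y + t • (x - y) - f‖ ≤ (1 - t) * ‖y - f‖ + t * ‖x - f‖ := by
    have heq : y + t • (x - y) - f = (1 - t) • (y - f) + t • (x - f) := by module
    rw [heq]
    refine (norm_add_le _ _).trans_eq ?_
    rw [norm_smul, norm_smul, Real.norm_of_nonneg (sub_nonneg.2 ht1.le),
      Real.norm_of_nonneg ht0.le]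
  nlinarith [hmin _ ht, mul_pos ht0 (sub_pos.2 hlt)]

/-- Lemma 1 (Existence of a Feasible Solution): for a nonempty polyhedron and any
point `f`, there is a subset of the constraints and a point `y` satisfying those
constraints with equality, lying in the polyhedron, and minimizing the distance to
`f` among all points of the corresponding affine set. -/
theorem exists_feasible_projection_candidate (m n : ℕ)
    (a : Fin n → EuclideanSpace ℝ (Fin m)) (b : Fin n → ℝ)
    (hP : ({x : EuclideanSpace ℝ (Fin m) | ∀ i : Fin n, ⟪a i, x⟫_ℝ ≤ b i}).Nonempty)
    (f : EuclideanSpace ℝ (Fin m)) :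
    ∃ (I : Finset (Fin n)) (y : EuclideanSpace ℝ (Fin m)),
      (∀ i ∈ I, ⟪a i, y⟫_ℝ = b i) ∧
      (∀ i : Fin n, ⟪a i, y⟫_ℝ ≤ b i) ∧
      (∀ x : EuclideanSpace ℝ (Fin m), (∀ i ∈ I, ⟪a i, x⟫_ℝ = b i) → ‖y - f‖ ≤ ‖x - f‖) := by
  have hclosed : IsClosed {x : EuclideanSpace ℝ (Fin m) | ∀ i : Fin n, ⟪a i, x⟫_ℝ ≤ b i} := by
    simp only [Set.ofPred_forall]
    exact isClosed_iInter fun i => isClosed_le (by fun_prop) continuous_const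
  obtain ⟨y, hy, hdist⟩ := hclosed.exists_infDist_eq_dist hP f
  refine ⟨Finset.univ.filter fun i => ⟪a i, y⟫_ℝ = b i, y, by simp, hy, fun x hx => ?_⟩
  refine norm_sub_le_of_forall_active_eq hy (fun z hz => ?_) fun i hi => hx i (by simpa using hi)
  rw [← dist_eq_norm, ← dist_eq_norm, dist_comm y, dist_comm z, ← hdist]
  exact Metric.infDist_le_dist_of_mem hz
end

section
/- Let T > 0, let h : ℝ → ℝ be continuous on [0, T] and differentiable at every t ∈ [0, T), and let α : ℝ → ℝ be Lipschitz with constant L ≥ 0 and satisfy α 0 = 0. If h 0 ≥ 0 and deriv h t ≥ −α (h t) for all t ∈ [0, T), then h t ≥ 0 for all t ∈ [0, T]. -/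
/-- Comparison-lemma step: if `h` is continuous on `[0, T]`, differentiable on
`[0, T)`, `α` is Lipschitz with `α 0 = 0`, `h 0 ≥ 0`, and `deriv h t ≥ −α (h t)`
on `[0, T)`, then `h t ≥ 0` on `[0, T]`. -/
theorem barrier_comparison_lemma (T : ℝ) (hT : 0 < T)
    (h α : ℝ → ℝ) (L : ℝ) (hL : 0 ≤ L)
    (hcont : ContinuousOn h (Set.Icc 0 T))
    (hdiff : ∀ t ∈ Set.Ico 0 T, DifferentiableAt ℝ h t)
    (hlip : LipschitzWith L.toNNReal α) (hα0 : α 0 = 0)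
    (h0 : 0 ≤ h 0)
    (hineq : ∀ t ∈ Set.Ico 0 T, -α (h t) ≤ deriv h t) :
    ∀ t ∈ Set.Icc 0 T, 0 ≤ h t := by
  intro t ht
  have hα : ∀ y, α y ≤ L * |y| := fun y => by
    have := hlip.dist_le_mul y 0
    rw [hα0, Real.dist_eq, Real.dist_eq, sub_zero, sub_zero, Real.coe_toNNReal L hL] at this
    exact (le_abs_self _).trans this
  -- `-h` cannot cross the strict supersolution `ε * exp ((L + 1) * s)`.
  have hfence : ∀ ε > 0, -h t ≤ ε * Real.exp ((L + 1) * t) := fun ε hε => by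
    have hB : ∀ s, HasDerivAt (fun s => ε * Real.exp ((L + 1) * s))
        (ε * (Real.exp ((L + 1) * s) * (L + 1))) s := fun s => by
      simpa using (((hasDerivAt_id s).const_mul (L + 1)).exp).const_mul ε
    refine image_le_of_deriv_right_lt_deriv_boundary (f := fun s => -h s)
      (f' := fun s => -deriv h s) hcont.neg
      (fun s hs => (hdiff s hs).hasDerivAt.neg.hasDerivWithinAt) ?_ hB ?_ ht
    · simp only [mul_zero, Real.exp_zero, mul_one]
      linarith
    · intro s hs heq
      have hpos : 0 < ε * Real.exp ((L + 1) * s) := by positivity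
      have hle := hα (h s)
      rw [← abs_neg, heq, abs_of_pos hpos] at hle
      linarith [hineq s hs]
  have hlim : Filter.Tendsto (fun ε : ℝ => ε * Real.exp ((L + 1) * t))
      (nhdsWithin 0 (Set.Ioi 0)) (nhds 0) :=
    ((continuous_id.mul continuous_const).tendsto' 0 0 (zero_mul _)).mono_left
      nhdsWithin_le_nhds
  exact neg_nonpos.mp
    (ge_of_tendsto hlim (Filter.eventually_of_mem self_mem_nhdsWithin hfence))
end

section
/- Let T > 0. Let x : ℝ → ℝ^n be differentiable on [0, T], let h : ℝ^n → ℝ be differentiable (continuously differentiable suffices), and let α : ℝ → ℝ be Lipschitz with α 0 = 0. Suppose that for every t ∈ [0, T], the derivative of h along the trajectory satisfies fderiv ℝ h (x t) (deriv x t) ≥ −α (h (x t)), and that h (x 0) ≥ 0. Then h (x t) ≥ 0 for all t ∈ [0, T]; i.e., the superlevel set C = {x : h(x) ≥ 0} is forward invariant along the trajectory. -/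
/-- Comparison principle: a function satisfying `-α y ≤ y'` with `α` Lipschitz and `α 0 = 0`
stays nonnegative if it starts nonnegative. -/
theorem nonneg_of_neg_lipschitz_le_deriv {a b : ℝ} {y y' α : ℝ → ℝ} {L : NNReal}
    (hα : LipschitzWith L α) (hα0 : α 0 = 0) (hy : ContinuousOn y (Set.Icc a b))
    (hy' : ∀ t ∈ Set.Ico a b, HasDerivWithinAt y (y' t) (Set.Ici t) t)
    (hbound : ∀ t ∈ Set.Ico a b, -α (y t) ≤ y' t) (ha : 0 ≤ y a) :
    ∀ t ∈ Set.Icc a b, 0 ≤ y t := by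
  intro t ht
  have key : ∀ ε > 0, -y t ≤ ε * Real.exp ((L + 1) * t) := by
    intro ε hε
    have hB (s : ℝ) : HasDerivAt (fun s ↦ ε * Real.exp ((L + 1) * s))
        (ε * (Real.exp ((L + 1) * s) * (L + 1))) s := by
      simpa using (((hasDerivAt_id s).const_mul ((L : ℝ) + 1)).exp).const_mul ε
    refine image_le_of_deriv_right_lt_deriv_boundary hy.neg (fun s hs ↦ (hy' s hs).neg)
      ?_ hB ?_ ht
    · have : 0 < ε * Real.exp ((L + 1) * a) := by positivity
      simp only [Pi.neg_apply]
      linarith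
    · intro s hs hs_eq
      simp only [Pi.neg_apply] at hs_eq
      have hpos : 0 < ε * Real.exp ((L + 1) * s) := by positivity
      have hlip : α (y s) ≤ L * |y s| := by
        have hdist := hα.dist_le_mul (y s) 0
        rw [hα0, Real.dist_eq, Real.dist_eq, sub_zero, sub_zero] at hdist
        exact (le_abs_self _).trans hdist
      rw [abs_of_neg (by linarith), hs_eq] at hlip
      linarith [hbound s hs]
  by_contra! hneg
  have hexp := Real.exp_pos ((L + 1) * t)
  have hle := key (-y t / (2 * Real.exp ((L + 1) * t))) (div_pos (by linarith) (by positivity))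
  have hhalf : -y t / (2 * Real.exp ((L + 1) * t)) * Real.exp ((L + 1) * t) = -y t / 2 := by
    field_simp
  linarith

/-- Differentiable-solution form of Theorem 1 (Safe-by-Design Neural Network
Controllers): if the CBF condition holds along a differentiable trajectory with a
Lipschitz class-K-type function `α` vanishing at `0`, then the safe set
`{x | h x ≥ 0}` is forward invariant along the trajectory. -/
theorem safe_by_design_forward_invariance (n : ℕ) (T : ℝ) (hT : 0 < T)
    (x : ℝ → EuclideanSpace ℝ (Fin n))
    (hx : ∀ t ∈ Set.Icc 0 T, DifferentiableAt ℝ x t)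
    (h : EuclideanSpace ℝ (Fin n) → ℝ) (hh : Differentiable ℝ h)
    (α : ℝ → ℝ) (L : NNReal) (hα : LipschitzWith L α) (hα0 : α 0 = 0)
    (hineq : ∀ t ∈ Set.Icc 0 T, -α (h (x t)) ≤ fderiv ℝ h (x t) (deriv x t))
    (h0 : 0 ≤ h (x 0)) :
    ∀ t ∈ Set.Icc 0 T, 0 ≤ h (x t) := by
  have hd : ∀ t ∈ Set.Icc 0 T,
      HasDerivAt (fun s ↦ h (x s)) (fderiv ℝ h (x t) (deriv x t)) t := fun t ht ↦
    (hh (x t)).hasFDerivAt.comp_hasDerivAt t (hx t ht).hasDerivAt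
  exact nonneg_of_neg_lipschitz_le_deriv hα hα0
    (fun t ht ↦ (hd t ht).continuousAt.continuousWithinAt)
    (fun t ht ↦ (hd t (Set.Ico_subset_Icc_self ht)).hasDerivWithinAt)
    (fun t ht ↦ hineq t (Set.Ico_subset_Icc_self ht)) h0
end
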